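/- arXiv:1802.08674 — 3 statements merged into one kernel-verified Lean document; each statement's English description precedes it below -/
import Mathlib

section
/- Let k and T be positive integers and let p^1, …, p^T ∈ ℝ^k be vectors with ‖p^t‖₂ ≤ 1 for all t. Define V_0 := I_k (the k×k identity matrix) and V_t := I_k + ∑_{τ=1}^{t} p^τ (p^τ)ᵀ for 1 ≤ t ≤ T. Then log det(V_T) ≤ ∑_{t=1}^{T} (p^t)ᵀ V_{t−1}^{−1} p^t ≤ 2 log det(V_T). -/
open Matrix

section EllipticalPotential

variable {n : Type*} [Fintype n] [DecidableEq n]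

/-- The rank-one case of the matrix determinant lemma. -/
theorem det_add_vecMulVec_of_isUnit_det {A : Matrix n n ℝ} (hA : IsUnit A.det) (u v : n → ℝ) :
    (A + vecMulVec u v).det = A.det * (1 + v ⬝ᵥ (A⁻¹ *ᵥ u)) := by
  rw [vecMulVec_eq Unit, det_add_replicateCol_mul_replicateRow hA, Matrix.mul_assoc,
    ← replicateCol_mulVec, det_unique (n := Unit)]
  simp

/-- If `A - 1` is positive semidefinite, then `A⁻¹` is at most the identity as a quadratic form. -/
theorem dotProduct_inv_mulVec_le_dotProduct_self {A : Matrix n n ℝ} (hA : A.PosDef)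
    (hA1 : (A - 1).PosSemidef) (x : n → ℝ) : x ⬝ᵥ (A⁻¹ *ᵥ x) ≤ x ⬝ᵥ x := by
  set y := A⁻¹ *ᵥ x with hy
  have hAy : A *ᵥ y = x := by
    rw [hy, mulVec_mulVec, mul_nonsing_inv _ hA.det_pos.ne'.isUnit, one_mulVec]
  have h1 : 0 ≤ y ⬝ᵥ ((A - 1) *ᵥ y) := by simpa using hA1.dotProduct_mulVec_nonneg y
  rw [sub_mulVec, one_mulVec, hAy, dotProduct_sub, dotProduct_comm y x] at h1
  have h2 : 0 ≤ (x - y) ⬝ᵥ (x - y) := by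
    simpa using dotProduct_star_self_nonneg (x - y)
  rw [dotProduct_sub, sub_dotProduct, sub_dotProduct, dotProduct_comm y x] at h2
  linarith

end EllipticalPotential

theorem le_two_mul_log_one_add {x : ℝ} (h0 : 0 ≤ x) (h1 : x ≤ 1) : x ≤ 2 * Real.log (1 + x) := by
  have h := Real.le_log_one_add_of_nonneg h0
  have h' : x / 2 ≤ 2 * x / (x + 2) := by
    rw [div_le_div_iff₀ (by norm_num) (by linarith)]
    nlinarith
  linarith

/-- For vectors `p^1, …, p^T` of ℓ₂-norm at most 1 and
`V_t = I + ∑_{τ≤t} p^τ (p^τ)ᵀ`, the elliptical-potential bounds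
`log det V_T ≤ ∑_t (p^t)ᵀ V_{t−1}^{−1} p^t ≤ 2 log det V_T` hold. -/
theorem stmt3 (k T : ℕ) (hk : 0 < k) (hT : 0 < T)
    (p : ℕ → Fin k → ℝ)
    (hp : ∀ t ∈ Finset.Icc 1 T, Real.sqrt (p t ⬝ᵥ p t) ≤ 1)
    (V : ℕ → Matrix (Fin k) (Fin k) ℝ)
    (hV : ∀ t, V t = 1 + ∑ τ ∈ Finset.Icc 1 t, Matrix.vecMulVec (p τ) (p τ)) :
    Real.log (V T).det ≤ (∑ t ∈ Finset.Icc 1 T, p t ⬝ᵥ ((V (t - 1))⁻¹ *ᵥ p t)) ∧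
      (∑ t ∈ Finset.Icc 1 T, p t ⬝ᵥ ((V (t - 1))⁻¹ *ᵥ p t)) ≤ 2 * Real.log (V T).det := by
  have hS (t : ℕ) : (V t - 1).PosSemidef := by
    rw [hV t, add_sub_cancel_left]
    exact posSemidef_sum _ fun τ _ => by simpa using posSemidef_vecMulVec_self_star (p τ)
  have hP (t : ℕ) : (V t).PosDef := by
    simpa using PosDef.one.add_posSemidef (hS t)
  have hx (t : ℕ) : 0 ≤ p (t + 1) ⬝ᵥ ((V t)⁻¹ *ᵥ p (t + 1)) := by
    simpa using (hP t).inv.posSemidef.dotProduct_mulVec_nonneg (p (t + 1))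
  have hlog (t : ℕ) : Real.log (V (t + 1)).det =
      Real.log (V t).det + Real.log (1 + p (t + 1) ⬝ᵥ ((V t)⁻¹ *ᵥ p (t + 1))) := by
    have hstep : V (t + 1) = V t + vecMulVec (p (t + 1)) (p (t + 1)) := by
      rw [hV, hV, Finset.sum_Icc_succ_top (by omega), add_assoc]
    rw [hstep, det_add_vecMulVec_of_isUnit_det (hP t).det_pos.ne'.isUnit,
      Real.log_mul (hP t).det_pos.ne' (by linarith [hx t])]
  clear hT
  induction T with
  | zero => simp [hV 0]
  | succ t ih =>
    obtain ⟨ihl, ihu⟩ := ih fun s hs => hp s (Finset.Icc_subset_Icc_right t.le_succ hs)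
    have hnorm : p (t + 1) ⬝ᵥ p (t + 1) ≤ 1 := by
      simpa using hp (t + 1) (by simp)
    have hx1 := (dotProduct_inv_mulVec_le_dotProduct_self (hP t) (hS t) (p (t + 1))).trans hnorm
    have hu := le_two_mul_log_one_add (hx t) hx1
    have hl := Real.log_le_sub_one_of_pos (by linarith [hx t] :
      0 < 1 + p (t + 1) ⬝ᵥ ((V t)⁻¹ *ᵥ p (t + 1)))
    rw [Finset.sum_Icc_succ_top (by omega), hlog t, Nat.add_sub_cancel]
    constructor <;> linarith
end

section
/- Let k and T be positive integers and let p^1, …, p^T ∈ ℝ^k be vectors with ‖p^t‖₂ ≤ 1 for all t. Then det(I_k + ∑_{t=1}^{T} p^t (p^t)ᵀ) ≤ (1 + T/k)^k. -/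
open Matrix

/-- The AM-GM inequality with natural-number exponents over a finite type. -/
theorem prod_le_mean_pow_card {ι : Type*} [Fintype ι] [Nonempty ι] (z : ι → ℝ)
    (hz : ∀ i, 0 ≤ z i) :
    ∏ i, z i ≤ ((∑ i, z i) / Fintype.card ι) ^ Fintype.card ι := by
  have hcard : 0 < Fintype.card ι := Fintype.card_pos
  have h := Real.geom_mean_le_arith_mean Finset.univ (fun _ => (1 : ℝ)) z
    (fun _ _ => zero_le_one) (by simpa using hcard) (fun i _ => hz i)
  simp only [Real.rpow_one, one_mul, Finset.sum_const, Finset.card_univ, nsmul_eq_mul,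
    mul_one] at h
  have hprod : 0 ≤ ∏ i, z i := Finset.prod_nonneg fun i _ => hz i
  calc ∏ i, z i = ((∏ i, z i) ^ ((Fintype.card ι : ℝ)⁻¹)) ^ Fintype.card ι :=
        (Real.rpow_inv_natCast_pow hprod hcard.ne').symm
    _ ≤ _ := pow_le_pow_left₀ (Real.rpow_nonneg hprod _) h _

/-- The determinant of a real positive semidefinite matrix is at most the power of its
normalized trace. -/
theorem Matrix.PosSemidef.det_le_trace_div_card_pow {n : Type*} [Fintype n] [DecidableEq n]
    [Nonempty n] {A : Matrix n n ℝ} (hA : A.PosSemidef) :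
    A.det ≤ (A.trace / Fintype.card n) ^ Fintype.card n := by
  rw [hA.isHermitian.det_eq_prod_eigenvalues, hA.isHermitian.trace_eq_sum_eigenvalues]
  exact prod_le_mean_pow_card _ hA.eigenvalues_nonneg

/-- For vectors `p^1, …, p^T` of ℓ₂-norm at most 1,
`det(I + ∑_t p^t (p^t)ᵀ) ≤ (1 + T/k)^k`. -/
theorem stmt5 (k T : ℕ) (hk : 0 < k) (hT : 0 < T)
    (p : ℕ → Fin k → ℝ)
    (hp : ∀ t ∈ Finset.Icc 1 T, Real.sqrt (p t ⬝ᵥ p t) ≤ 1) :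
    ((1 : Matrix (Fin k) (Fin k) ℝ) +
        ∑ t ∈ Finset.Icc 1 T, Matrix.vecMulVec (p t) (p t)).det ≤
      (1 + (T : ℝ) / k) ^ k := by
  have : Nonempty (Fin k) := ⟨⟨0, hk⟩⟩
  have hk' : (0 : ℝ) < k := Nat.cast_pos.mpr hk
  have hA : ((1 : Matrix (Fin k) (Fin k) ℝ) +
      ∑ t ∈ Finset.Icc 1 T, Matrix.vecMulVec (p t) (p t)).PosSemidef :=
    Matrix.PosSemidef.one.add <| Matrix.posSemidef_sum _ fun t _ => by
      simpa using Matrix.posSemidef_vecMulVec_self_star (p t)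
  have htrace : ((1 : Matrix (Fin k) (Fin k) ℝ) +
      ∑ t ∈ Finset.Icc 1 T, Matrix.vecMulVec (p t) (p t)).trace ≤ k + T := by
    rw [Matrix.trace_add, Matrix.trace_one, Fintype.card_fin, Matrix.trace_sum]
    simp only [Matrix.trace_vecMulVec]
    gcongr
    calc ∑ t ∈ Finset.Icc 1 T, p t ⬝ᵥ p t ≤ ∑ t ∈ Finset.Icc 1 T, (1 : ℝ) :=
          Finset.sum_le_sum fun t ht => by simpa using Real.sqrt_le_iff.mp (hp t ht)
      _ = T := by simp
  have h := hA.det_le_trace_div_card_pow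
  rw [Fintype.card_fin] at h
  refine h.trans (pow_le_pow_left₀ (div_nonneg hA.trace_nonneg hk'.le) ?_ k)
  rw [div_le_iff₀ hk', add_mul, div_mul_cancel₀ _ hk'.ne', one_mul]
  exact htrace
end

section
/- Let k be a positive integer, let G_1, …, G_g be a partition of {1,…,k} into nonempty sets, let μ ∈ ℝ^k, and let ℓ, u ∈ ℝ^g. Let C := {p ∈ ℝ^k : p is a probability vector and ℓ_i ≤ ∑_{a∈G_i} p_a ≤ u_i for all i ∈ {1,…,g}}, and let Q := {q ∈ ℝ^g : q_i ≥ 0 for all i, ∑_{i=1}^g q_i = 1, and ℓ_i ≤ q_i ≤ u_i for all i}. If C is nonempty, then sup_{p∈C} μᵀp = sup_{q∈Q} ∑_{i=1}^{g} q_i · (max_{a∈G_i} μ_a). In other words, the fair-constrained linear program over arms decomposes: the optimal within-group allocation places all of each group's mass on its best arm. -/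
open Matrix

/-- A sum over all arms splits into the sums over the groups of a partition. -/
theorem sum_eq_sum_sum_of_partition {α ι : Type*} [Fintype α] [Fintype ι]
    (G : ι → Finset α) (hdisj : ∀ i j, i ≠ j → Disjoint (G i) (G j))
    (hcover : ∀ a, ∃ i, a ∈ G i) (f : α → ℝ) :
    ∑ a, f a = ∑ i, ∑ a ∈ G i, f a := by
  classical
  rw [← Finset.sum_biUnion fun i _ j _ hij => hdisj i j hij]
  congr 1
  ext a
  simpa using hcover a

/-- If `p` puts the mass `q i` of each group `i` on the representative `b i`, then a
`p`-weighted sum over a group is its value at the representative. -/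
theorem sum_mul_sum_ite_of_partition {α ι : Type*} [DecidableEq α] [Fintype ι]
    (G : ι → Finset α) (hdisj : ∀ i j, i ≠ j → Disjoint (G i) (G j))
    (b : ι → α) (hb : ∀ i, b i ∈ G i) (q : ι → ℝ) (f : α → ℝ) (i : ι) :
    ∑ a ∈ G i, f a * (∑ j, if a = b j then q j else 0) = f (b i) * q i := by
  simp_rw [Finset.mul_sum]
  rw [Finset.sum_comm, Finset.sum_eq_single i]
  · simp [hb i]
  · intro j _ hji
    have h : b j ∉ G i := Finset.disjoint_left.mp (hdisj j i hji) (hb j)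
    simp [h]
  · simp

/-- Decomposition of the fair-constrained LP for a partition of arms into
groups: the supremum of `μᵀp` over fair probability vectors `p` equals the
supremum over fair group-level distributions `q` of
`∑ i, q_i · (max_{a ∈ G_i} μ_a)`. -/
theorem stmt12 (k g : ℕ) (hk : 0 < k) (hg : 0 < g)
    (G : Fin g → Finset (Fin k))
    (hGne : ∀ i, (G i).Nonempty)
    (hGdisj : ∀ i j, i ≠ j → Disjoint (G i) (G j))
    (hGcover : ∀ a, ∃ i, a ∈ G i)
    (μ : Fin k → ℝ) (l u : Fin g → ℝ)
    (C : Set (Fin k → ℝ))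
    (hC : C = {p | (∀ a, 0 ≤ p a) ∧ ∑ a, p a = 1 ∧
      ∀ i, l i ≤ ∑ a ∈ G i, p a ∧ ∑ a ∈ G i, p a ≤ u i})
    (Q : Set (Fin g → ℝ))
    (hQ : Q = {q | (∀ i, 0 ≤ q i) ∧ ∑ i, q i = 1 ∧ ∀ i, l i ≤ q i ∧ q i ≤ u i})
    (hCne : C.Nonempty) :
    sSup ((fun p => μ ⬝ᵥ p) '' C) =
      sSup ((fun q => ∑ i, q i * (G i).sup' (hGne i) μ) '' Q) := by
  subst hC hQ
  apply csSup_eq_csSup_of_forall_exists_le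
  · rintro _ ⟨p, ⟨hp0, hp1, hpb⟩, rfl⟩
    refine ⟨_, ⟨fun i => ∑ a ∈ G i, p a,
      ⟨fun i => Finset.sum_nonneg fun a _ => hp0 a, ?_, hpb⟩, rfl⟩, ?_⟩
    · rw [← sum_eq_sum_sum_of_partition G hGdisj hGcover, hp1]
    · simp only [dotProduct]
      rw [sum_eq_sum_sum_of_partition G hGdisj hGcover]
      refine Finset.sum_le_sum fun i _ => ?_
      rw [Finset.sum_mul]
      refine Finset.sum_le_sum fun a ha => ?_
      rw [mul_comm]
      exact mul_le_mul_of_nonneg_left (Finset.le_sup' μ ha) (hp0 a)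
  · rintro _ ⟨q, ⟨hq0, hq1, hqb⟩, rfl⟩
    choose b hb hbμ using fun i => Finset.exists_mem_eq_sup' (hGne i) μ
    have hgroup := sum_mul_sum_ite_of_partition G hGdisj b hb q
    have hmass (i : Fin g) : ∑ a ∈ G i, (∑ j, if a = b j then q j else 0) = q i := by
      simpa only [one_mul] using hgroup (fun _ => 1) i
    refine ⟨_, ⟨fun a => ∑ j, if a = b j then q j else 0, ⟨fun a => ?_, ?_, fun i => ?_⟩, rfl⟩, ?_⟩
    · exact Finset.sum_nonneg fun j _ => by split_ifs <;> simp [hq0 j]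
    · rw [sum_eq_sum_sum_of_partition G hGdisj hGcover]
      simp_rw [hmass, hq1]
    · rw [hmass]
      exact hqb i
    · simp only [dotProduct]
      rw [sum_eq_sum_sum_of_partition G hGdisj hGcover]
      simp_rw [hgroup, hbμ, mul_comm]
      exact le_rfl
end
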